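/- Let v be a complete Llull matrix on a finite set A, with rank-like rates R and indirect comparison relation ν = {(x,y) : v*_{xy} > v*_{yx}}. Then: (a) R_x < R_y implies (x,y) ∈ ν; (b) if the codual ν̂ = {(x,y) : x ≠ y, v*_{xy} ≥ v*_{yx}} is transitive (which holds in particular whenever ν is total), then R_x < R_y if and only if (x,y) ∈ ν; (c) if ν contains a set of the form X × Y where X and Y partition A, then R_x < R_y for every x ∈ X and y ∈ Y. -/

import Mathlib

/-! Common definitions: valued relations, indirect scores, admissible orders,
projected margins/scores, rank-like rates (Camps–Mora–Saumell CLC method). -/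

variable {A : Type*} [Fintype A] [DecidableEq A]

/-- The score of a chain `x₀ :: x₁ :: ... :: xₙ`: the minimum of `v xᵢ xᵢ₊₁`
over its links (value `1` for chains with no link, which we never use). -/
noncomputable def linkScore (v : A → A → ℝ) : List A → ℝ
  | [] => 1
  | [_] => 1
  | [a, b] => v a b
  | a :: b :: c :: l => min (v a b) (linkScore v (b :: c :: l))

/-- The indirect score `v*_{xy}`: the supremum (= maximum) of the scores of all
paths from `x` to `y` (with at least one link, consecutive elements distinct). -/
noncomputable def istar (v : A → A → ℝ) (x y : A) : ℝ :=
  sSup { s : ℝ | ∃ l : List A, List.Chain' (· ≠ ·) (x :: (l ++ [y])) ∧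
      s = linkScore v (x :: (l ++ [y])) }

/-- `ξ` is a strict total order: irreflexive, transitive, total. -/
def StrictTotal (ξ : A → A → Prop) : Prop :=
  (∀ x, ¬ ξ x x) ∧ (∀ x y z, ξ x y → ξ y z → ξ x z) ∧ (∀ x y, x ≠ y → ξ x y ∨ ξ y x)

/-- `ξ` is admissible for `v`: `v*_{xy} > v*_{yx}` implies `x` precedes `y`. -/
def Adm (v : A → A → ℝ) (ξ : A → A → Prop) : Prop :=
  ∀ x y, istar v x y > istar v y x → ξ x y

/-- Intermediate projected margin `m^σ_{xy}` (for `x` preceding `y` in `ξ`):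
the infimum (= minimum) of the indirect margins `m*_{pq}` over `p ⪯ x`, `y ⪯ q`. -/
noncomputable def msigma (v : A → A → ℝ) (ξ : A → A → Prop) (x y : A) : ℝ :=
  sInf { s : ℝ | ∃ p q, (ξ p x ∨ p = x) ∧ (ξ y q ∨ q = y) ∧
      s = istar v p q - istar v q p }

/-- `q` is the immediate successor of `p` in `ξ`. -/
def ImmSucc (ξ : A → A → Prop) (p q : A) : Prop :=
  ξ p q ∧ ∀ z, ¬ (ξ p z ∧ ξ z q)

/-- Projected margin (for `x` preceding `y` in `ξ`): the supremum (= maximum) of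
`m^σ_{p p'}` over `x ⪯ p ≺ y`, `p'` the immediate successor of `p`. -/
noncomputable def mpiAux (v : A → A → ℝ) (ξ : A → A → Prop) (x y : A) : ℝ :=
  sSup { s : ℝ | ∃ p q, (ξ x p ∨ p = x) ∧ ξ p y ∧ ImmSucc ξ p q ∧
      s = msigma v ξ p q }

open Classical in
/-- Projected margins `m^π`, extended antisymmetrically. -/
noncomputable def mpi (v : A → A → ℝ) (ξ : A → A → Prop) (x y : A) : ℝ :=
  if ξ x y then mpiAux v ξ x y else - mpiAux v ξ y x

/-- Projected scores `v^π_{xy} = (1 + m^π_{xy})/2`. -/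
noncomputable def vpi (v : A → A → ℝ) (ξ : A → A → Prop) (x y : A) : ℝ :=
  (1 + mpi v ξ x y) / 2

/-- Rank-like rate `R_x = N - ∑_{y ≠ x} v^π_{xy}`. -/
noncomputable def rlr (v : A → A → ℝ) (ξ : A → A → Prop) (x : A) : ℝ :=
  (Fintype.card A : ℝ) - ∑ y ∈ Finset.univ.erase x, vpi v ξ x y

/-- `v` is a complete Llull matrix: scores of distinct pairs lie in `[0,1]`
and satisfy `v_{xy} + v_{yx} = 1`. -/
def Llull (v : A → A → ℝ) : Prop :=
  ∀ x y : A, x ≠ y → 0 ≤ v x y ∧ v x y ≤ 1 ∧ v x y + v y x = 1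

/-! Projected margins inherit monotonicity along an admissible order, and are positive across any
cut of the order that separates its two sides by positive indirect margins. -/

section ProjectedMargins

variable {v : A → A → ℝ} {ξ : A → A → Prop}

section Order

omit [Fintype A] [DecidableEq A]

theorem StrictTotal.asymm (hξ : StrictTotal ξ) {x y : A} (hxy : ξ x y) : ¬ ξ y x :=
  fun hyx => hξ.1 x (hξ.2.1 x y x hxy hyx)

theorem StrictTotal.of_eq_or_trans (hξ : StrictTotal ξ) {x p y : A} (h : ξ x p ∨ p = x)
    (hpy : ξ p y) : ξ x y := by
  rcases h with h | rfl
  exacts [hξ.2.1 _ _ _ h hpy, hpy]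

theorem StrictTotal.le_of_not (hξ : StrictTotal ξ) {x y : A} (h : ¬ ξ x y) : ξ y x ∨ x = y := by
  by_cases hxy : x = y
  · exact Or.inr hxy
  · exact Or.inl ((hξ.2.2 x y hxy).resolve_left h)

theorem ImmSucc.le_of_lt (hξ : StrictTotal ξ) {p q y : A} (hpq : ImmSucc ξ p q) (hpy : ξ p y) :
    ξ q y ∨ y = q :=
  hξ.le_of_not fun h => hpq.2 y ⟨hpy, h⟩

end Order

section Margins

omit [DecidableEq A]

theorem StrictTotal.exists_immSucc_of_cut (hξ : StrictTotal ξ) (P : A → Prop) {x y : A}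
    (hxy : ξ x y) (hx : P x) (hy : ¬ P y) :
    ∃ p q, (ξ x p ∨ p = x) ∧ ξ p y ∧ ImmSucc ξ p q ∧ P p ∧ ¬ P q := by
  have : IsTrans A ξ := ⟨hξ.2.1⟩
  have : Std.Irrefl ξ := ⟨hξ.1⟩
  have wf : WellFounded ξ := Finite.wellFounded_of_trans_of_irrefl ξ
  have wf' : WellFounded (Function.swap ξ) := Finite.wellFounded_of_trans_of_irrefl _
  obtain ⟨p, ⟨hpP, hpy⟩, hmax⟩ := wf'.has_min {p | P p ∧ ξ p y} ⟨x, hx, hxy⟩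
  obtain ⟨q, hpq, hmin⟩ := wf.has_min {q | ξ p q} ⟨y, hpy⟩
  have hsucc : ImmSucc ξ p q := ⟨hpq, fun z hz => hmin z hz.1 hz.2⟩
  refine ⟨p, q, ?_, hpy, hsucc, hpP, fun hq => ?_⟩
  · exact hξ.le_of_not fun h => hmax x ⟨hx, hxy⟩ h
  · rcases hsucc.le_of_lt hξ hpy with h | rfl
    · exact hmax q ⟨hq, h⟩ hpq
    · exact hy hq

omit [Fintype A] in
theorem istar_le_of_adm (hξ : StrictTotal ξ) (hadm : Adm v ξ) {p q : A} (hpq : ξ p q) :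
    istar v q p ≤ istar v p q :=
  not_lt.1 fun h => hξ.asymm hpq (hadm q p h)

theorem finite_msigma_set (v : A → A → ℝ) (ξ : A → A → Prop) (x y : A) :
    { s : ℝ | ∃ p q, (ξ p x ∨ p = x) ∧ (ξ y q ∨ q = y) ∧
      s = istar v p q - istar v q p }.Finite := by
  refine (Set.finite_range fun r : A × A => istar v r.1 r.2 - istar v r.2 r.1).subset ?_
  rintro s ⟨p, q, -, -, rfl⟩
  exact ⟨(p, q), rfl⟩

theorem finite_mpiAux_set (v : A → A → ℝ) (ξ : A → A → Prop) (x y : A) :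
    { s : ℝ | ∃ p q, (ξ x p ∨ p = x) ∧ ξ p y ∧ ImmSucc ξ p q ∧ s = msigma v ξ p q }.Finite := by
  refine (Set.finite_range fun r : A × A => msigma v ξ r.1 r.2).subset ?_
  rintro s ⟨p, q, -, -, -, rfl⟩
  exact ⟨(p, q), rfl⟩

theorem msigma_le {x y p q : A} (hp : ξ p x ∨ p = x) (hq : ξ y q ∨ q = y) :
    msigma v ξ x y ≤ istar v p q - istar v q p :=
  csInf_le (finite_msigma_set v ξ x y).bddBelow ⟨p, q, hp, hq, rfl⟩

theorem msigma_pos {x y : A} (h : ∀ p q, (ξ p x ∨ p = x) → (ξ y q ∨ q = y) →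
    istar v p q > istar v q p) : 0 < msigma v ξ x y := by
  obtain ⟨p, q, hp, hq, hs⟩ := Set.Nonempty.csInf_mem
    (⟨_, x, y, Or.inr rfl, Or.inr rfl, rfl⟩ : Set.Nonempty { s : ℝ | ∃ p q, (ξ p x ∨ p = x) ∧
      (ξ y q ∨ q = y) ∧ s = istar v p q - istar v q p }) (finite_msigma_set v ξ x y)
  rw [msigma, hs]
  exact sub_pos.2 (h p q hp hq)

omit [Fintype A] in
theorem msigma_nonneg (hξ : StrictTotal ξ) (hadm : Adm v ξ) {x y : A} (hxy : ξ x y) :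
    0 ≤ msigma v ξ x y := by
  refine Real.sInf_nonneg ?_
  rintro s ⟨p, q, hp, hq, rfl⟩
  have hpy : ξ p y := by
    rcases hp with hp | rfl
    exacts [hξ.2.1 _ _ _ hp hxy, hxy]
  have hpq : ξ p q := by
    rcases hq with hq | rfl
    exacts [hξ.2.1 _ _ _ hpy hq, hpy]
  exact sub_nonneg.2 (istar_le_of_adm hξ hadm hpq)

omit [Fintype A] in
theorem mpiAux_nonneg (hξ : StrictTotal ξ) (hadm : Adm v ξ) (x y : A) : 0 ≤ mpiAux v ξ x y := by
  refine Real.sSup_nonneg ?_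
  rintro s ⟨p, q, -, -, hpq, rfl⟩
  exact msigma_nonneg hξ hadm hpq.1

theorem msigma_le_mpiAux {x y p q : A} (hp : ξ x p ∨ p = x) (hpy : ξ p y) (hpq : ImmSucc ξ p q) :
    msigma v ξ p q ≤ mpiAux v ξ x y :=
  le_csSup (finite_mpiAux_set v ξ x y).bddAbove ⟨p, q, hp, hpy, hpq, rfl⟩

omit [Fintype A] in
theorem mpiAux_eq_zero (hξ : StrictTotal ξ) {x y : A} (h : ¬ ξ x y) : mpiAux v ξ x y = 0 := by
  rw [mpiAux]
  convert Real.sSup_empty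
  refine Set.eq_empty_of_forall_notMem ?_
  rintro s ⟨p, q, hp, hpy, -⟩
  exact h (hξ.of_eq_or_trans hp hpy)

omit [Fintype A] in
theorem mpi_eq_sub (hξ : StrictTotal ξ) (x y : A) :
    mpi v ξ x y = mpiAux v ξ x y - mpiAux v ξ y x := by
  by_cases h : ξ x y
  · rw [mpi, if_pos h, mpiAux_eq_zero hξ (hξ.asymm h), sub_zero]
  · rw [mpi, if_neg h, mpiAux_eq_zero hξ h, zero_sub]

omit [Fintype A] in
theorem mpi_self (hξ : StrictTotal ξ) (x : A) : mpi v ξ x x = 0 := by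
  rw [mpi_eq_sub hξ, sub_self]

theorem mpi_le_mpi_of_lt (hξ : StrictTotal ξ) (hadm : Adm v ξ) {x y : A} (hxy : ξ x y) (z : A) :
    mpi v ξ y z ≤ mpi v ξ x z := by
  rw [mpi_eq_sub hξ, mpi_eq_sub hξ]
  refine sub_le_sub (Real.sSup_le ?_ (mpiAux_nonneg hξ hadm x z))
    (Real.sSup_le ?_ (mpiAux_nonneg hξ hadm z y))
  · rintro s ⟨p, q, hp, hpz, hpq, rfl⟩
    refine msigma_le_mpiAux (Or.inl ?_) hpz hpq
    rcases hp with hp | rfl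
    exacts [hξ.2.1 _ _ _ hxy hp, hxy]
  · rintro s ⟨p, q, hp, hpx, hpq, rfl⟩
    exact msigma_le_mpiAux hp (hξ.2.1 _ _ _ hpx hxy) hpq

theorem mpi_le_mpi_of_tie (hξ : StrictTotal ξ) (hadm : Adm v ξ) {x y : A}
    (htie : istar v x y ≤ istar v y x) (z : A) : mpi v ξ x z ≤ mpi v ξ y z := by
  have hnonpos : ∀ {p q}, (ξ x p ∨ p = x) → ξ p y → ImmSucc ξ p q → msigma v ξ p q ≤ 0 := by
    intro p q hp hpy hpq
    exact (msigma_le (hp.imp id Eq.symm) (hpq.le_of_lt hξ hpy)).trans (sub_nonpos.2 htie)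
  rw [mpi_eq_sub hξ, mpi_eq_sub hξ]
  refine sub_le_sub (Real.sSup_le ?_ (mpiAux_nonneg hξ hadm y z))
    (Real.sSup_le ?_ (mpiAux_nonneg hξ hadm z x))
  · rintro s ⟨p, q, hp, hpz, hpq, rfl⟩
    by_cases hpy : ξ p y
    · exact (hnonpos hp hpy hpq).trans (mpiAux_nonneg hξ hadm y z)
    · exact msigma_le_mpiAux (hξ.le_of_not hpy) hpz hpq
  · rintro s ⟨p, q, hp, hpy, hpq, rfl⟩
    by_cases hpx : ξ p x
    · exact msigma_le_mpiAux hp hpx hpq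
    · exact (hnonpos (hξ.le_of_not hpx) hpy hpq).trans (mpiAux_nonneg hξ hadm z x)

end Margins

theorem rlr_eq_sum_univ (hξ : StrictTotal ξ) (x : A) :
    rlr v ξ x = (Fintype.card A : ℝ) + 1 / 2 - ∑ z, vpi v ξ x z := by
  rw [rlr, ← Finset.add_sum_erase _ _ (Finset.mem_univ x)]
  simp only [vpi, mpi_self hξ]
  ring

theorem rlr_le_rlr (hξ : StrictTotal ξ) {x y : A} (h : ∀ z, mpi v ξ y z ≤ mpi v ξ x z) :
    rlr v ξ x ≤ rlr v ξ y := by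
  rw [rlr_eq_sum_univ hξ, rlr_eq_sum_univ hξ]
  refine sub_le_sub_left (Finset.sum_le_sum fun z _ => ?_) _
  have := h z
  simp only [vpi]
  linarith

theorem rlr_lt_rlr_of_msigma_pos (hξ : StrictTotal ξ) (hadm : Adm v ξ) {x y p q : A}
    (hp : ξ x p ∨ p = x) (hpy : ξ p y) (hpq : ImmSucc ξ p q) (hpos : 0 < msigma v ξ p q) :
    rlr v ξ x < rlr v ξ y := by
  have hxy : ξ x y := hξ.of_eq_or_trans hp hpy
  rw [rlr_eq_sum_univ hξ, rlr_eq_sum_univ hξ]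
  refine sub_lt_sub_left (Finset.sum_lt_sum (fun z _ => ?_) ⟨y, Finset.mem_univ y, ?_⟩) _
  · have := mpi_le_mpi_of_lt hξ hadm hxy z
    simp only [vpi]
    linarith
  · have := hpos.trans_le (msigma_le_mpiAux hp hpy hpq)
    have hmpi : mpi v ξ x y = mpiAux v ξ x y := if_pos hxy
    simp only [vpi, mpi_self hξ, hmpi]
    linarith

end ProjectedMargins

/-- (a) `R_x < R_y` implies `(x,y) ∈ ν`; (b) if the codual `ν̂`
is transitive then `R_x < R_y ↔ (x,y) ∈ ν`; (c) if `ν ⊇ X × Y` for a partition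
`A = X ∪ Y`, then `R_x < R_y` for all `x ∈ X`, `y ∈ Y`. -/
theorem stmt11 {A : Type*} [Fintype A] [DecidableEq A] (v : A → A → ℝ)
    (hv : Llull v) (ξ : A → A → Prop) (hξ : StrictTotal ξ) (hadm : Adm v ξ) :
    (∀ x y : A, x ≠ y → rlr v ξ x < rlr v ξ y → istar v x y > istar v y x) ∧
    ((∀ x y z : A, x ≠ y → y ≠ z → x ≠ z →
        (x ≠ y ∧ istar v x y ≥ istar v y x) →
        (y ≠ z ∧ istar v y z ≥ istar v z y) →
        (x ≠ z ∧ istar v x z ≥ istar v z x)) →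
      ∀ x y : A, x ≠ y →
        (rlr v ξ x < rlr v ξ y ↔ istar v x y > istar v y x)) ∧
    (∀ X Y : Set A, Disjoint X Y → X ∪ Y = Set.univ →
      (∀ x ∈ X, ∀ y ∈ Y, x ≠ y ∧ istar v x y > istar v y x) →
      ∀ x ∈ X, ∀ y ∈ Y, rlr v ξ x < rlr v ξ y) := by
  have hlt : ∀ x y : A, x ≠ y → rlr v ξ x < rlr v ξ y → istar v x y > istar v y x := by
    intro x y hxy hR
    by_contra hν
    refine absurd hR (not_lt.2 (rlr_le_rlr hξ ?_))
    rcases hξ.2.2 x y hxy with _ | h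
    · exact mpi_le_mpi_of_tie hξ hadm (not_lt.1 hν)
    · exact mpi_le_mpi_of_lt hξ hadm h
  refine ⟨hlt, fun htrans x y hxy => ⟨hlt x y hxy, fun hν => ?_⟩, ?_⟩
  · have htr : ∀ {a b c : A}, istar v b a ≤ istar v a b → istar v c b ≤ istar v b c →
        istar v c a ≤ istar v a c := by
      intro a b c hab hbc
      by_cases h₁ : a = b
      · rwa [h₁]
      by_cases h₂ : b = c
      · rwa [← h₂]
      by_cases h₃ : a = c
      · rw [h₃]
      exact (htrans a b c h₁ h₂ h₃ ⟨h₁, hab⟩ ⟨h₂, hbc⟩).2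
    have hle : ∀ {a b : A}, (ξ a b ∨ b = a) → istar v b a ≤ istar v a b := by
      rintro a b (h | rfl)
      exacts [istar_le_of_adm hξ hadm h, le_rfl]
    obtain ⟨p, q, hp, hpy, hpq, hpP, hqP⟩ := hξ.exists_immSucc_of_cut
      (fun p => istar v p y > istar v y p) (hadm x y hν) hν (lt_irrefl _)
    refine rlr_lt_rlr_of_msigma_pos hξ hadm hp hpy hpq (msigma_pos fun a b ha hb => ?_)
    by_contra hab
    exact not_le.2 hpP (htr (htr (htr (not_lt.1 hqP) (hle hb)) (not_lt.1 hab))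
      (hle (ha.imp id Eq.symm)))
  · intro X Y hdisj hunion hXY x hx y hy
    have hmem : ∀ a, a ∉ X → a ∈ Y := fun a ha =>
      ((hunion ▸ Set.mem_univ a : a ∈ X ∪ Y)).resolve_left ha
    have hbefore : ∀ {a b}, a ∈ X → b ∈ Y → ξ a b := fun ha hb => hadm _ _ (hXY _ ha _ hb).2
    obtain ⟨p, q, hp, hpy, hpq, hpX, hqX⟩ := hξ.exists_immSucc_of_cut
      (· ∈ X) (hbefore hx hy) hx fun h => Set.disjoint_left.1 hdisj h hy
    refine rlr_lt_rlr_of_msigma_pos hξ hadm hp hpy hpq (msigma_pos fun a b ha hb => ?_)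
    refine (hXY a ?_ b (hmem b fun hbX => ?_)).2
    · rcases ha with ha | rfl
      · by_contra haX
        exact hξ.asymm ha (hbefore hpX (hmem a haX))
      · exact hpX
    · rcases hb with hb | rfl
      · exact hξ.asymm hb (hbefore hbX (hmem q hqX))
      · exact hqX hbX
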